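/- arXiv:2509.02405 — 6 statements merged into one kernel-verified Lean document; each statement's English description precedes it below -/
import Mathlib

section
/- Let 1 ≤ p < ∞ be a real number. Every strictly singular bounded linear operator from ℓ_p to ℓ_p is a compact operator. -/
/-- A bounded linear operator `T : E → F` between normed spaces is *strictly singular* if
for every infinite-dimensional subspace `M` of `E` and every `c > 0` there exists `x ∈ M`
with `‖T x‖ < c * ‖x‖`. -/
def StrictlySingular {E F : Type*} [NormedAddCommGroup E] [NormedSpace ℝ E]
    [NormedAddCommGroup F] [NormedSpace ℝ F] (T : E →L[ℝ] F) : Prop :=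
  ∀ M : Submodule ℝ E, ¬ FiniteDimensional ℝ M → ∀ c : ℝ, 0 < c → ∃ x ∈ M, ‖T x‖ < c * ‖x‖

open Filter Topology
open scoped ENNReal

section SequenceSpace

variable {p : ℝ≥0∞}

/-- The `p`-th power of the norm is additive on finite families of disjointly supported elements
of `ℓ_p`. -/
lemma norm_sum_rpow_of_disjoint {ι : Type*} (hp : 0 < p.toReal)
    (s : Finset ι) (w : ι → lp (fun _ : ℕ => ℝ) p)
    (hw : ∀ k l, k ≠ l → ∀ i, w k i = 0 ∨ w l i = 0) :
    ‖∑ k ∈ s, w k‖ ^ p.toReal = ∑ k ∈ s, ‖w k‖ ^ p.toReal := by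
  classical
  induction s using Finset.induction_on with
  | empty => simp [Real.zero_rpow hp.ne']
  | insert a s ha ih =>
    rw [Finset.sum_insert ha, Finset.sum_insert ha, ← ih]
    refine (lp.hasSum_norm hp _).unique ?_
    convert (lp.hasSum_norm hp (w a)).add (lp.hasSum_norm hp (∑ k ∈ s, w k)) using 1
    funext i
    rw [lp.coeFn_add, Pi.add_apply]
    by_cases hi : w a i = 0
    · simp only [hi, norm_zero, zero_add, Real.zero_rpow hp.ne']
    · have : (∑ k ∈ s, w k : lp (fun _ : ℕ => ℝ) p) i = 0 := by
        rw [lp.coeFn_sum, Finset.sum_apply]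
        refine Finset.sum_eq_zero fun k hk => ?_
        exact (hw a k (by rintro rfl; exact ha hk) i).resolve_left hi
      simp only [this, norm_zero, add_zero, Real.zero_rpow hp.ne']

lemma abs_le_rpow_sum {ι : Type*} {q : ℝ} (hq : 0 < q) (s : Finset ι) (a : ι → ℝ) {k : ι}
    (hk : k ∈ s) : |a k| ≤ (∑ j ∈ s, |a j| ^ q) ^ q⁻¹ := by
  rw [Real.le_rpow_inv_iff_of_pos (abs_nonneg _) (by positivity) hq]
  exact Finset.single_le_sum (f := fun j => |a j| ^ q) (fun j _ => by positivity) hk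

section Perturbation

variable {ι : Type*} [Fact (1 ≤ p)] {u w : ι → lp (fun _ : ℕ => ℝ) p} {δ : ι → ℝ} {η : ℝ}

lemma norm_sum_smul_sub_le (hp : 0 < p.toReal) (s : Finset ι) (a : ι → ℝ)
    (hδ : ∀ k, ‖u k - w k‖ ≤ δ k) (hη : ∑ k ∈ s, δ k ≤ η) :
    ‖∑ k ∈ s, a k • u k - ∑ k ∈ s, a k • w k‖
      ≤ η * (∑ k ∈ s, |a k| ^ p.toReal) ^ p.toReal⁻¹ := by
  rw [← Finset.sum_sub_distrib]
  calc ‖∑ k ∈ s, (a k • u k - a k • w k)‖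
      ≤ ∑ k ∈ s, δ k * (∑ k ∈ s, |a k| ^ p.toReal) ^ p.toReal⁻¹ := by
        refine norm_sum_le_of_le _ fun k hk => ?_
        rw [← smul_sub, norm_smul, mul_comm, Real.norm_eq_abs]
        exact mul_le_mul (hδ k) (abs_le_rpow_sum hp s a hk) (abs_nonneg _)
          ((norm_nonneg _).trans (hδ k))
    _ ≤ _ := by
        rw [← Finset.sum_mul]
        gcongr

lemma norm_sum_smul_rpow_of_disjoint (hp : 0 < p.toReal) (s : Finset ι) (a : ι → ℝ)
    (hw : ∀ k l, k ≠ l → ∀ i, w k i = 0 ∨ w l i = 0) :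
    ‖∑ k ∈ s, a k • w k‖ ^ p.toReal = ∑ k ∈ s, |a k| ^ p.toReal * ‖w k‖ ^ p.toReal := by
  rw [norm_sum_rpow_of_disjoint hp s (fun k => a k • w k)]
  · refine Finset.sum_congr rfl fun k _ => ?_
    rw [norm_smul, Real.norm_eq_abs, Real.mul_rpow (abs_nonneg _) (norm_nonneg _)]
  · intro k l hkl i
    rcases hw k l hkl i with h | h <;> simp [h]

lemma norm_sum_smul_le (hp : 0 < p.toReal) (s : Finset ι) (a : ι → ℝ)
    (hw : ∀ k l, k ≠ l → ∀ i, w k i = 0 ∨ w l i = 0)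
    (hδ : ∀ k, ‖u k - w k‖ ≤ δ k) (hη : ∑ k ∈ s, δ k ≤ η) {C : ℝ} (hC : 0 ≤ C)
    (hwC : ∀ k, ‖w k‖ ≤ C) :
    ‖∑ k ∈ s, a k • u k‖ ≤ (C + η) * (∑ k ∈ s, |a k| ^ p.toReal) ^ p.toReal⁻¹ := by
  have h : ‖∑ k ∈ s, a k • w k‖ ≤ C * (∑ k ∈ s, |a k| ^ p.toReal) ^ p.toReal⁻¹ := by
    rw [← Real.rpow_le_rpow_iff (norm_nonneg _) (by positivity) hp,
      norm_sum_smul_rpow_of_disjoint hp s a hw, Real.mul_rpow hC (by positivity),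
      Real.rpow_inv_rpow (by positivity) hp.ne', Finset.mul_sum]
    refine Finset.sum_le_sum fun k _ => ?_
    rw [mul_comm]
    gcongr
    exact hwC k
  have h' := norm_sum_smul_sub_le hp s a hδ hη
  have := norm_le_norm_add_norm_sub' (∑ k ∈ s, a k • u k) (∑ k ∈ s, a k • w k)
  linarith

lemma le_norm_sum_smul (hp : 0 < p.toReal) (s : Finset ι) (a : ι → ℝ)
    (hw : ∀ k l, k ≠ l → ∀ i, w k i = 0 ∨ w l i = 0)
    (hδ : ∀ k, ‖u k - w k‖ ≤ δ k) (hη : ∑ k ∈ s, δ k ≤ η) {c : ℝ} (hc : 0 ≤ c)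
    (hwc : ∀ k, c ≤ ‖w k‖) :
    (c - η) * (∑ k ∈ s, |a k| ^ p.toReal) ^ p.toReal⁻¹ ≤ ‖∑ k ∈ s, a k • u k‖ := by
  have h : c * (∑ k ∈ s, |a k| ^ p.toReal) ^ p.toReal⁻¹ ≤ ‖∑ k ∈ s, a k • w k‖ := by
    rw [← Real.rpow_le_rpow_iff (by positivity) (norm_nonneg _) hp,
      norm_sum_smul_rpow_of_disjoint hp s a hw, Real.mul_rpow hc (by positivity),
      Real.rpow_inv_rpow (by positivity) hp.ne', Finset.mul_sum]
    refine Finset.sum_le_sum fun k _ => ?_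
    rw [mul_comm]
    gcongr
    exact hwc k
  have h' := norm_sum_smul_sub_le hp s a hδ hη
  have := norm_le_norm_add_norm_sub (∑ k ∈ s, a k • u k) (∑ k ∈ s, a k • w k)
  linarith

end Perturbation

section Truncation

variable [Fact (1 ≤ p)]

variable (p) in
/-- Truncation of a sequence in `ℓ_p` to its first `n` coordinates. -/
noncomputable def truncateCLM (n : ℕ) :
    lp (fun _ : ℕ => ℝ) p →L[ℝ] lp (fun _ : ℕ => ℝ) p :=
  ∑ i ∈ Finset.range n, (lp.singleContinuousLinearMap ℝ (fun _ : ℕ => ℝ) p i).comp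
    (lp.evalCLM ℝ (fun _ : ℕ => ℝ) p i)

lemma truncateCLM_eq_sum (n : ℕ) (f : lp (fun _ : ℕ => ℝ) p) :
    truncateCLM p n f = ∑ i ∈ Finset.range n, lp.single p i (f i) := by
  simp only [truncateCLM, sum_apply]
  rfl

lemma truncateCLM_apply (n : ℕ) (f : lp (fun _ : ℕ => ℝ) p) (i : ℕ) :
    truncateCLM p n f i = if i < n then f i else 0 := by
  rw [truncateCLM_eq_sum, lp.coeFn_sum, Finset.sum_apply]
  simp [lp.single_apply, Pi.single_apply]

lemma tendsto_truncateCLM (hp : p ≠ ∞) (f : lp (fun _ : ℕ => ℝ) p) :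
    Tendsto (fun n => truncateCLM p n f) atTop (𝓝 f) := by
  simp only [truncateCLM_eq_sum]
  exact (lp.hasSum_single hp f).tendsto_sum_nat

lemma isCompactOperator_truncateCLM (n : ℕ) : IsCompactOperator (truncateCLM p n) := by
  refine sum_mem (S := compactOperator (RingHom.id ℝ) (lp (fun _ : ℕ => ℝ) p)
    (lp (fun _ : ℕ => ℝ) p)) fun i _ => ?_
  exact (isCompactOperator_of_locallyCompactSpace_rng
    (lp.singleContinuousLinearMap ℝ (fun _ : ℕ => ℝ) p i)).comp_clm _

end Truncation

end SequenceSpace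

/-- A bounded sequence contains two distinct terms whose images under a compact operator are
arbitrarily close. -/
lemma IsCompactOperator.exists_norm_sub_lt {E F : Type*} [NormedAddCommGroup E] [NormedSpace ℝ E]
    [NormedAddCommGroup F] [NormedSpace ℝ F] {f : E →L[ℝ] F} (hf : IsCompactOperator f)
    {x : ℕ → E} (hx : ∀ n, ‖x n‖ ≤ 1) {δ : ℝ} (hδ : 0 < δ) :
    ∃ m n, m < n ∧ ‖f (x m - x n)‖ < δ := by
  have hK : IsCompact (closure (f '' Metric.closedBall 0 1)) :=
    hf.isCompact_closure_image_closedBall (f := (f : E →ₗ[ℝ] F)) 1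
  obtain ⟨y, -, φ, hφ, hy⟩ := hK.tendsto_subseq (x := fun n => f (x n))
    fun n => subset_closure ⟨x n, by simpa using hx n, rfl⟩
  obtain ⟨N, hN⟩ := Metric.cauchySeq_iff.1 hy.cauchySeq δ hδ
  refine ⟨φ N, φ (N + 1), hφ N.lt_succ_self, ?_⟩
  rw [map_sub, ← dist_eq_norm]
  exact hN N le_rfl (N + 1) N.le_succ

/-- A bounded operator into a Banach space that is not compact sends some sequence in the unit ball
to a uniformly separated sequence. -/
lemma exists_seq_separated_of_not_isCompactOperator {E F : Type*} [NormedAddCommGroup E]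
    [NormedSpace ℝ E] [NormedAddCommGroup F] [NormedSpace ℝ F] [CompleteSpace F] {T : E →L[ℝ] F}
    (hT : ¬ IsCompactOperator T) :
    ∃ ε > 0, ∃ x : ℕ → E, (∀ n, ‖x n‖ ≤ 1) ∧ ∀ m n, m < n → ε ≤ ‖T (x m - x n)‖ := by
  contrapose! hT
  refine (isCompactOperator_iff_isCompact_closure_image_closedBall (T : E →ₗ[ℝ] F)
    one_pos).2 (TotallyBounded.isCompact_of_isClosed (TotallyBounded.closure ?_) isClosed_closure)
  rw [Metric.totallyBounded_iff]
  intro ε hε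
  by_contra! h
  obtain ⟨x, hx, hxT⟩ := exists_seq_of_forall_finset_exists (fun x : E => ‖x‖ ≤ 1)
    (fun x y => ε ≤ ‖T (x - y)‖) fun s _ => by
      have := h (T '' s) (s.finite_toSet.image _)
      rw [Set.not_subset] at this
      obtain ⟨_, ⟨y, hy, rfl⟩, hys⟩ := this
      refine ⟨y, by simpa using hy, fun x hx => ?_⟩
      by_contra! hlt
      refine hys (Set.mem_biUnion (Set.mem_image_of_mem T hx) ?_)
      rw [Metric.mem_ball, dist_comm, dist_eq_norm]
      simpa using hlt
  obtain ⟨m, n, hmn, hlt⟩ := hT ε hε x hx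
  exact absurd (hxT m n hmn) (not_le.2 hlt)

section GlidingHump

variable {p : ℝ≥0∞} [Fact (1 ≤ p)] {T : lp (fun _ : ℕ => ℝ) p →L[ℝ] lp (fun _ : ℕ => ℝ) p}

/-- One step of the gliding hump construction for a separated sequence and its image. -/
lemma exists_almost_block (hp : p ≠ ∞) {ε : ℝ} {x : ℕ → lp (fun _ : ℕ => ℝ) p}
    (hx : ∀ n, ‖x n‖ ≤ 1) (hxT : ∀ m n, m < n → ε ≤ ‖T (x m - x n)‖) (N : ℕ) {δ : ℝ}
    (hδ : 0 < δ) :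
    ∃ (u : lp (fun _ : ℕ => ℝ) p) (M : ℕ), N ≤ M ∧ ‖u‖ ≤ 2 ∧ ε ≤ ‖T u‖ ∧
      ‖u - (truncateCLM p M u - truncateCLM p N u)‖ ≤ δ ∧
      ‖T u - (truncateCLM p M (T u) - truncateCLM p N (T u))‖ ≤ δ := by
  have hP := isCompactOperator_truncateCLM (p := p) N
  have hF : IsCompactOperator ((truncateCLM p N).prod ((truncateCLM p N).comp T)) := by
    have := (hP.clm_comp (ContinuousLinearMap.inl ℝ _ (lp (fun _ : ℕ => ℝ) p))).add
      ((hP.comp_clm T).clm_comp (ContinuousLinearMap.inr ℝ (lp (fun _ : ℕ => ℝ) p) _))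
    refine (congrArg IsCompactOperator (funext fun y => ?_)).mp this
    simp
  obtain ⟨m, n, hmn, hlt⟩ := hF.exists_norm_sub_lt hx (half_pos hδ)
  set u := x m - x n with hu
  have h1 : ‖truncateCLM p N u‖ < δ / 2 := (norm_fst_le _).trans_lt hlt
  have h2 : ‖truncateCLM p N (T u)‖ < δ / 2 := (norm_snd_le _).trans_lt hlt
  have key (y : lp (fun _ : ℕ => ℝ) p) :
      ∀ᶠ M in atTop, ‖y - truncateCLM p M y‖ < δ / 2 := by
    filter_upwards [Metric.tendsto_nhds.1 (tendsto_truncateCLM hp y) _ (half_pos hδ)] with M hM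
    rwa [dist_comm, dist_eq_norm] at hM
  obtain ⟨M, hM1, hM2, hNM⟩ := ((key u).and ((key (T u)).and (eventually_ge_atTop N))).exists
  refine ⟨u, M, hNM, ?_, hxT m n hmn, ?_, ?_⟩
  · linarith [norm_sub_le (x m) (x n), hx m, hx n]
  · rw [← sub_add]
    linarith [norm_add_le (u - truncateCLM p M u) (truncateCLM p N u)]
  · rw [← sub_add]
    linarith [norm_add_le (T u - truncateCLM p M (T u)) (truncateCLM p N (T u))]

/-- Differences of truncations along a monotone sequence of indices are disjointly supported. -/
lemma truncateCLM_sub_disjoint {N : ℕ → ℕ} (hN : Monotone N) (u : ℕ → lp (fun _ : ℕ => ℝ) p)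
    (k l : ℕ) (hkl : k ≠ l) (i : ℕ) :
    (truncateCLM p (N (k + 1)) (u k) - truncateCLM p (N k) (u k)) i = 0 ∨
      (truncateCLM p (N (l + 1)) (u l) - truncateCLM p (N l) (u l)) i = 0 := by
  simp only [lp.coeFn_sub, Pi.sub_apply, truncateCLM_apply]
  have hk := hN k.le_succ
  have hl := hN l.le_succ
  rcases hkl.lt_or_gt with h | h
  · have : N (k + 1) ≤ N l := hN h
    grind
  · have : N (l + 1) ≤ N k := hN h
    grind

/-- A non-compact operator on `ℓ_p` acts as an isomorphic embedding on the span of some linearly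
independent sequence. -/
lemma exists_linearIndependent_of_not_isCompactOperator (hp : p ≠ ∞)
    (hT : ¬ IsCompactOperator T) :
    ∃ u : ℕ → lp (fun _ : ℕ => ℝ) p, LinearIndependent ℝ u ∧
      ∃ c > 0, ∀ y ∈ Submodule.span ℝ (Set.range u), c * ‖y‖ ≤ ‖T y‖ := by
  have hp' : 0 < p.toReal := ENNReal.toReal_pos (zero_lt_one.trans_le Fact.out).ne' hp
  obtain ⟨ε, hε, x, hx, hxT⟩ := exists_seq_separated_of_not_isCompactOperator hT
  set δ : ℕ → ℝ := fun k => ε / 8 * (1 / 2) ^ k with hδ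
  have hδ0 (k : ℕ) : 0 < δ k := by positivity
  have hδle (k : ℕ) : δ k ≤ ε / 8 :=
    mul_le_of_le_one_right (by positivity) (pow_le_one₀ (by norm_num) (by norm_num))
  have hδsum (s : Finset ℕ) : ∑ k ∈ s, δ k ≤ ε / 4 := by
    have h := (hasSum_geometric_two).mul_left (ε / 8)
    have := sum_le_hasSum s (fun k _ => (hδ0 k).le) h
    linarith
  choose U M hNM hU hTU hUδ hTUδ using
    fun (N : ℕ) (k : ℕ) => exists_almost_block hp hx hxT N (hδ0 k)
  let N : ℕ → ℕ := fun k => Nat.rec 0 (fun j n => M n j) k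
  have hN : Monotone N := monotone_nat_of_le_succ fun k => hNM (N k) k
  set u : ℕ → lp (fun _ : ℕ => ℝ) p := fun k => U (N k) k
  have hw := truncateCLM_sub_disjoint hN u
  have hTw := truncateCLM_sub_disjoint hN fun k => T (u k)
  have hud (k : ℕ) : ‖u k - (truncateCLM p (N (k + 1)) (u k) - truncateCLM p (N k) (u k))‖ ≤ δ k :=
    hUδ (N k) k
  have hTud (k : ℕ) :
      ‖T (u k) - (truncateCLM p (N (k + 1)) (T (u k)) - truncateCLM p (N k) (T (u k)))‖ ≤ δ k :=
    hTUδ (N k) k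
  have upper (s : Finset ℕ) (a : ℕ → ℝ) := norm_sum_smul_le hp' s a hw hud (hδsum s)
    (C := 2 + ε / 8) (by positivity) fun k => by
      have h1 := norm_le_norm_add_norm_sub (u k)
        (truncateCLM p (N (k + 1)) (u k) - truncateCLM p (N k) (u k))
      have h2 : ‖u k‖ ≤ 2 := hU (N k) k
      linarith [hud k, hδle k]
  have lower (s : Finset ℕ) (a : ℕ → ℝ) := le_norm_sum_smul hp' s a hTw hTud (hδsum s)
    (c := ε / 2) (by positivity) fun k => by
      have h1 := norm_le_norm_add_norm_sub' (T (u k))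
        (truncateCLM p (N (k + 1)) (T (u k)) - truncateCLM p (N k) (T (u k)))
      have h2 : ε ≤ ‖T (u k)‖ := hTU (N k) k
      linarith [hTud k, hδle k]
  refine ⟨u, ?_, ε / 4 / (2 + ε), by positivity, fun y hy => ?_⟩
  · rw [linearIndependent_iff']
    intro s a ha k hk
    have h1 := lower s a
    simp only [← map_smul, ← map_sum, ha, map_zero, norm_zero] at h1
    have h2 := abs_le_rpow_sum hp' s a hk
    have h3 : |a k| ≤ 0 := by nlinarith
    exact abs_nonpos_iff.1 h3
  · obtain ⟨a, rfl⟩ := Finsupp.mem_span_range_iff_exists_finsupp.1 hy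
    have h1 := lower a.support a
    have h2 := upper a.support a
    simp only [← map_smul, ← map_sum] at h1
    rw [Finsupp.sum]
    set S := (∑ k ∈ a.support, |a k| ^ p.toReal) ^ p.toReal⁻¹
    have hS : 0 ≤ S := by positivity
    calc ε / 4 / (2 + ε) * ‖∑ k ∈ a.support, a k • u k‖
        ≤ ε / 4 / (2 + ε) * ((2 + ε) * S) := by
          gcongr
          nlinarith
      _ = (ε / 2 - ε / 4) * S := by field_simp; ring
      _ ≤ _ := h1

end GlidingHump

/-- Every strictly singular operator on `ℓ_p` (`1 ≤ p < ∞`) is compact. -/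
theorem strictlySingular_isCompactOperator_lp (p : ℝ) (hp : 1 ≤ p)
    [Fact (1 ≤ ENNReal.ofReal p)]
    (T : lp (fun _ : ℕ => ℝ) (ENNReal.ofReal p) →L[ℝ] lp (fun _ : ℕ => ℝ) (ENNReal.ofReal p))
    (hT : StrictlySingular T) : IsCompactOperator ⇑T := by
  by_contra hT'
  obtain ⟨u, hu, c, hc, hcT⟩ :=
    exists_linearIndependent_of_not_isCompactOperator ENNReal.ofReal_ne_top hT'
  have hinf : ¬ FiniteDimensional ℝ (Submodule.span ℝ (Set.range u)) := fun _ =>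
    not_finite_iff_infinite.2 inferInstance (linearIndependent_span hu).finite
  obtain ⟨y, hy, hlt⟩ := hT _ hinf c hc
  exact absurd (hcT y hy) (not_le.2 hlt)
end

section
/- Every strictly singular bounded linear operator from c₀ to c₀ is a compact operator, where c₀ is the Banach space of real sequences converging to zero with the supremum norm. -/
open scoped ZeroAtInfty

open Filter Topology

namespace CZero

/-- Truncation of a null sequence to its first `N` terms. -/
noncomputable def truncate (N : ℕ) (x : C₀(ℕ, ℝ)) : C₀(ℕ, ℝ) where
  toFun n := if n < N then x n else 0
  continuous_toFun := continuous_of_discreteTopology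
  zero_at_infty' := by
    rw [cocompact_eq_atTop]
    refine tendsto_const_nhds.congr' ?_
    filter_upwards [eventually_ge_atTop N] with n hn
    simp [not_lt.mpr hn]

/-- The `i`-th unit vector of `c₀`. -/
noncomputable def unitVec (i : ℕ) : C₀(ℕ, ℝ) where
  toFun n := if n = i then 1 else 0
  continuous_toFun := continuous_of_discreteTopology
  zero_at_infty' := by
    rw [cocompact_eq_atTop]
    refine tendsto_const_nhds.congr' ?_
    filter_upwards [eventually_gt_atTop i] with n hn
    simp [hn.ne']

theorem truncate_apply (N : ℕ) (x : C₀(ℕ, ℝ)) (n : ℕ) :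
    truncate N x n = if n < N then x n else 0 := rfl

theorem unitVec_apply (i n : ℕ) : unitVec i n = if n = i then 1 else 0 := rfl

theorem abs_apply_le_norm (x : C₀(ℕ, ℝ)) (n : ℕ) : |x n| ≤ ‖x‖ := by
  rw [← ZeroAtInftyContinuousMap.norm_toBCF_eq_norm]
  exact x.toBCF.norm_coe_le_norm n

theorem norm_le_of_forall {x : C₀(ℕ, ℝ)} {C : ℝ} (hC : 0 ≤ C) (h : ∀ n, |x n| ≤ C) :
    ‖x‖ ≤ C := by
  rw [← ZeroAtInftyContinuousMap.norm_toBCF_eq_norm]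
  exact (BoundedContinuousFunction.norm_le hC).2 h

theorem tendsto_apply (x : C₀(ℕ, ℝ)) : Tendsto (fun n ↦ x n) atTop (𝓝 0) := by
  rw [← cocompact_eq_atTop]
  exact x.zero_at_infty'

/-- Evaluation at a coordinate as a continuous linear functional on `c₀`. -/
noncomputable def coord (j : ℕ) : C₀(ℕ, ℝ) →L[ℝ] ℝ :=
  LinearMap.mkContinuous
    { toFun := fun x ↦ x j
      map_add' := fun _ _ ↦ rfl
      map_smul' := fun _ _ ↦ rfl } 1 fun x ↦ by simpa using abs_apply_le_norm x j

@[simp] theorem coord_apply (j : ℕ) (x : C₀(ℕ, ℝ)) : coord j x = x j := rfl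

theorem sum_apply {ι : Type*} (s : Finset ι) (f : ι → C₀(ℕ, ℝ)) (n : ℕ) :
    (∑ i ∈ s, f i) n = ∑ i ∈ s, f i n := map_sum (coord n) f s

theorem truncate_eq_sum (N : ℕ) (x : C₀(ℕ, ℝ)) :
    truncate N x = ∑ i ∈ Finset.range N, x i • unitVec i := by
  ext n
  simp [truncate_apply, sum_apply, unitVec_apply]

theorem tendsto_truncate (x : C₀(ℕ, ℝ)) : Tendsto (fun N ↦ truncate N x) atTop (𝓝 x) := by
  rw [Metric.tendsto_atTop]
  intro δ hδ
  obtain ⟨N, hN⟩ := Metric.tendsto_atTop.1 (tendsto_apply x) (δ / 2) (half_pos hδ)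
  refine ⟨N, fun m hm ↦ ?_⟩
  rw [dist_eq_norm]
  refine (norm_le_of_forall (half_pos hδ).le fun n ↦ ?_).trans_lt (half_lt_self hδ)
  rw [ZeroAtInftyContinuousMap.sub_apply, truncate_apply]
  split_ifs with h
  · simpa using (half_pos hδ).le
  · simpa using (hN n (by omega)).le

theorem summable_abs_apply_unitVec (φ : C₀(ℕ, ℝ) →L[ℝ] ℝ) :
    Summable fun i ↦ |φ (unitVec i)| := by
  refine summable_of_sum_le (c := ‖φ‖) (fun _ ↦ abs_nonneg _) fun s ↦ ?_
  set x : C₀(ℕ, ℝ) := ∑ i ∈ s, (SignType.sign (φ (unitVec i)) : ℝ) • unitVec i with hx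
  have hx1 : ‖x‖ ≤ 1 := norm_le_of_forall zero_le_one fun n ↦ by
    simp only [hx, sum_apply, ZeroAtInftyContinuousMap.smul_apply, unitVec_apply, smul_eq_mul,
      mul_ite, mul_one, mul_zero, Finset.sum_ite_eq]
    split_ifs
    · rcases SignType.sign (φ (unitVec n)) with _ | _ | _ <;> simp
    · simp
  calc ∑ i ∈ s, |φ (unitVec i)| = φ x := by simp [hx, sign_mul_self]
    _ ≤ ‖φ x‖ := le_abs_self _
    _ ≤ ‖φ‖ * ‖x‖ := φ.le_opNorm x
    _ ≤ ‖φ‖ := mul_le_of_le_one_right φ.opNorm_nonneg hx1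

theorem eventually_forall_abs_apply_le (φ : C₀(ℕ, ℝ) →L[ℝ] ℝ) {δ : ℝ} (hδ : 0 < δ) :
    ∀ᶠ N in atTop, ∀ x : C₀(ℕ, ℝ), ‖x‖ ≤ 1 → (∀ n < N, x n = 0) → |φ x| ≤ δ := by
  obtain ⟨s, hs⟩ := summable_iff_vanishing_norm.1 (summable_abs_apply_unitVec φ) δ hδ
  obtain ⟨N₀, hN₀⟩ := s.exists_nat_subset_range
  filter_upwards [eventually_ge_atTop N₀] with N hN x hx hxN
  refine le_of_tendsto ((φ.continuous.tendsto x).comp (tendsto_truncate x)).abs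
    (Eventually.of_forall fun m ↦ ?_)
  have hdisj : Disjoint (Finset.Ico N m) s := Finset.disjoint_left.2 fun i hi his ↦ by
    have := Finset.mem_range.1 (hN₀ his)
    have := (Finset.mem_Ico.1 hi).1
    omega
  calc |φ (truncate m x)| = |∑ i ∈ Finset.range m, x i * φ (unitVec i)| := by
        simp [truncate_eq_sum]
    _ = |∑ i ∈ Finset.Ico N m, x i * φ (unitVec i)| := by
        congr 1
        refine (Finset.sum_subset (fun i hi ↦ ?_) fun i _ hi ↦ ?_).symm
        · exact Finset.mem_range.2 (Finset.mem_Ico.1 hi).2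
        · rw [hxN i (by simp_all), zero_mul]
    _ ≤ ∑ i ∈ Finset.Ico N m, |x i * φ (unitVec i)| := Finset.abs_sum_le_sum_abs _ _
    _ ≤ ∑ i ∈ Finset.Ico N m, |φ (unitVec i)| := Finset.sum_le_sum fun i _ ↦ by
        rw [abs_mul]
        exact mul_le_of_le_one_left (abs_nonneg _) ((abs_apply_le_norm x i).trans hx)
    _ ≤ δ := (le_abs_self _).trans (hs _ hdisj).le

theorem isCompactOperator_of_forall_exists_tail {F : Type*} [NormedAddCommGroup F]
    [NormedSpace ℝ F] [CompleteSpace F] (T : C₀(ℕ, ℝ) →L[ℝ] F)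
    (h : ∀ ε > 0, ∃ N, ∀ x : C₀(ℕ, ℝ), ‖x‖ ≤ 1 → (∀ n < N, x n = 0) →
      (∀ᶠ n in atTop, x n = 0) → ‖T x‖ ≤ ε) : IsCompactOperator T := by
  have hfin (N : ℕ) : IsCompactOperator
      (∑ i ∈ Finset.range N, (coord i).smulRight (T (unitVec i)) : C₀(ℕ, ℝ) →L[ℝ] F) := by
    refine Finset.sum_induction _ (fun S : C₀(ℕ, ℝ) →L[ℝ] F ↦ IsCompactOperator S)
      (fun _ _ ↦ IsCompactOperator.add) isCompactOperator_zero fun i _ ↦ ?_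
    exact (isCompactOperator_of_locallyCompactSpace_rng
      (ContinuousLinearMap.toSpanSingleton ℝ (T (unitVec i)))).comp_clm (coord i)
  refine isClosed_setOfPred_isCompactOperator.closure_subset (Metric.mem_closure_iff.2 fun ε hε ↦ ?_)
  obtain ⟨N, hN⟩ := h (ε / 2) (half_pos hε)
  refine ⟨_, hfin N, ?_⟩
  rw [dist_eq_norm]
  refine (ContinuousLinearMap.opNorm_le_of_unit_norm (half_pos hε).le fun x hx ↦ ?_).trans_lt
    (half_lt_self hε)
  have heq : (T - ∑ i ∈ Finset.range N, (coord i).smulRight (T (unitVec i))) x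
      = T (x - truncate N x) := by
    simp [truncate_eq_sum]
  rw [heq]
  have hlim : Tendsto (fun m ↦ ‖T (truncate m (x - truncate N x))‖) atTop
      (𝓝 ‖T (x - truncate N x)‖) :=
    ((T.continuous.tendsto _).comp (tendsto_truncate _)).norm
  refine le_of_tendsto hlim (Eventually.of_forall fun m ↦ hN _ ?_ ?_ ?_)
  · refine norm_le_of_forall zero_le_one fun n ↦ ?_
    have := (abs_apply_le_norm x n).trans hx.le
    simp only [truncate_apply, ZeroAtInftyContinuousMap.sub_apply]
    split_ifs <;> simp [this]
  · intro n hn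
    simp [truncate_apply, hn]
  · filter_upwards [eventually_ge_atTop m] with n hn
    simp [truncate_apply, not_lt.2 hn]

/-- A gliding hump: if `T` is large on finitely supported vectors living arbitrarily far out, there
are disjointly supported `x l` in the unit ball and coordinates `j l` for which the matrix
`T (x l) (j i)` is almost diagonal. -/
theorem exists_almost_diagonal (T : C₀(ℕ, ℝ) →L[ℝ] C₀(ℕ, ℝ)) {ε : ℝ} (hε : 0 < ε)
    (h : ∀ N, ∃ x : C₀(ℕ, ℝ), ‖x‖ ≤ 1 ∧ (∀ n < N, x n = 0) ∧
      (∀ᶠ n in atTop, x n = 0) ∧ ε < ‖T x‖) :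
    ∃ (x : ℕ → C₀(ℕ, ℝ)) (j : ℕ → ℕ), (∀ l, ‖x l‖ ≤ 1) ∧ (∀ l, ε < |T (x l) (j l)|) ∧
      (∀ l i, l ≠ i → ∀ n, x l n = 0 ∨ x i n = 0) ∧
      ∀ l i, l ≠ i → |T (x l) (j i)| ≤ ε / 4 * (1 / 2) ^ l := by
  let P (p : ℕ × C₀(ℕ, ℝ) × ℕ) : Prop :=
    ‖p.2.1‖ ≤ 1 ∧ (∀ᶠ n in atTop, p.2.1 n = 0) ∧ ε < |T p.2.1 p.2.2|
  let r (p q : ℕ × C₀(ℕ, ℝ) × ℕ) : Prop :=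
    p.1 < q.1 ∧ (∀ n, p.2.1 n = 0 ∨ q.2.1 n = 0) ∧
      |T p.2.1 q.2.2| ≤ ε / 4 * (1 / 2) ^ p.1 ∧ |T q.2.1 p.2.2| ≤ ε / 4 * (1 / 2) ^ q.1
  have hstep (s : Finset (ℕ × C₀(ℕ, ℝ) × ℕ)) (hs : ∀ p ∈ s, P p) :
      ∃ q, P q ∧ ∀ p ∈ s, r p q := by
    set K := s.sup Prod.fst + 1
    obtain ⟨J, hJ⟩ : ∃ J, ∀ j ≥ J, ∀ p ∈ s, |T p.2.1 j| ≤ ε / 4 * (1 / 2) ^ p.1 := by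
      refine eventually_atTop.1 ((eventually_all_finset s).2 fun p _ ↦ ?_)
      have hlim := (tendsto_apply (T p.2.1)).abs
      rw [abs_zero] at hlim
      exact hlim.eventually_le_const (by positivity)
    have hrow := (eventually_all_finset s).2 fun p _ ↦
      eventually_forall_abs_apply_le ((coord p.2.2).comp T)
        (show 0 < ε / 4 * (1 / 2) ^ K by positivity)
    have hhead := (eventually_all_finset (Finset.range J)).2 fun j _ ↦
      eventually_forall_abs_apply_le ((coord j).comp T) hε
    have hsupp := (eventually_all_finset s).2 fun p hp ↦
      eventually_forall_ge_atTop.2 (hs p hp).2.1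
    obtain ⟨N, hN₁, hN₂, hN₃⟩ := (hrow.and (hhead.and hsupp)).exists
    obtain ⟨x, hx₁, hx₂, hx₃, hx₄⟩ := h N
    obtain ⟨j, hj⟩ : ∃ j, ε < |T x j| := by
      by_contra! hle
      exact hx₄.not_ge (norm_le_of_forall hε.le hle)
    have hJj : J ≤ j := by
      by_contra! hlt
      exact hj.not_ge (hN₂ j (Finset.mem_range.2 hlt) x hx₁ hx₂)
    refine ⟨(K, x, j), ⟨hx₁, hx₃, hj⟩, fun p hp ↦ ⟨?_, fun n ↦ ?_, hJ j hJj p hp,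
      hN₁ p hp x hx₁ hx₂⟩⟩
    · exact Nat.lt_succ_of_le (Finset.le_sup (f := Prod.fst) hp)
    · rcases lt_or_ge n N with hn | hn
      · exact Or.inr (hx₂ n hn)
      · exact Or.inl (hN₃ p hp n hn)
  obtain ⟨f, hf, hr⟩ := exists_seq_of_forall_finset_exists P r hstep
  have hmono : StrictMono fun n ↦ (f n).1 := fun m n hmn ↦ (hr m n hmn).1
  have hpow (l : ℕ) : ε / 4 * (1 / 2) ^ (f l).1 ≤ ε / 4 * (1 / 2) ^ l := by
    refine mul_le_mul_of_nonneg_left ?_ (by positivity)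
    exact pow_le_pow_of_le_one (by norm_num) (by norm_num) (hmono.le_apply (x := l))
  refine ⟨fun n ↦ (f n).2.1, fun n ↦ (f n).2.2, fun l ↦ (hf l).1, fun l ↦ (hf l).2.2,
    fun l i hli n ↦ ?_, fun l i hli ↦ ?_⟩
  · rcases hli.lt_or_gt with hlt | hlt
    · exact (hr l i hlt).2.1 n
    · exact ((hr i l hlt).2.1 n).symm
  · rcases hli.lt_or_gt with hlt | hlt
    · exact (hr l i hlt).2.2.1.trans (hpow l)
    · exact (hr i l hlt).2.2.2.trans (hpow l)

theorem norm_sum_smul_le_of_disjoint {x : ℕ → C₀(ℕ, ℝ)} (hx : ∀ l, ‖x l‖ ≤ 1)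
    (hdisj : ∀ l i, l ≠ i → ∀ n, x l n = 0 ∨ x i n = 0) (s : Finset ℕ) (a : ℕ → ℝ) {A : ℝ}
    (hA : 0 ≤ A) (ha : ∀ l ∈ s, |a l| ≤ A) : ‖∑ l ∈ s, a l • x l‖ ≤ A := by
  refine norm_le_of_forall hA fun n ↦ ?_
  rw [sum_apply]
  by_cases hn : ∃ l ∈ s, x l n ≠ 0
  · obtain ⟨l, hl, hln⟩ := hn
    rw [Finset.sum_eq_single_of_mem l hl fun i _ hil ↦ by
      simp [(hdisj i l hil n).resolve_right hln]]
    rw [ZeroAtInftyContinuousMap.smul_apply, smul_eq_mul, abs_mul]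
    exact (mul_le_of_le_one_right (abs_nonneg _) ((abs_apply_le_norm _ n).trans (hx l))).trans
      (ha l hl)
  · push Not at hn
    rw [Finset.sum_eq_zero fun l hl ↦ by simp [hn l hl]]
    simpa using hA

theorem le_norm_map_sum_smul {T : C₀(ℕ, ℝ) →L[ℝ] C₀(ℕ, ℝ)} {ε : ℝ} (hε : 0 < ε)
    {x : ℕ → C₀(ℕ, ℝ)} {j : ℕ → ℕ} (hdiag : ∀ l, ε < |T (x l) (j l)|)
    (hoff : ∀ l i, l ≠ i → |T (x l) (j i)| ≤ ε / 4 * (1 / 2) ^ l)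
    (s : Finset ℕ) (a : ℕ → ℝ) {i : ℕ} (hi : i ∈ s) (ha : ∀ l ∈ s, |a l| ≤ |a i|) :
    ε / 2 * |a i| ≤ ‖T (∑ l ∈ s, a l • x l)‖ := by
  refine le_trans ?_ (abs_apply_le_norm _ (j i))
  have heq : T (∑ l ∈ s, a l • x l) (j i)
      = a i * T (x i) (j i) + ∑ l ∈ s.erase i, a l * T (x l) (j i) := by
    rw [map_sum, sum_apply, ← Finset.add_sum_erase s _ hi]
    simp
  have hrest : |∑ l ∈ s.erase i, a l * T (x l) (j i)| ≤ ε / 2 * |a i| :=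
    calc |∑ l ∈ s.erase i, a l * T (x l) (j i)|
        ≤ ∑ l ∈ s.erase i, |a l * T (x l) (j i)| := Finset.abs_sum_le_sum_abs _ _
      _ ≤ ∑ l ∈ s.erase i, |a i| * (ε / 4) * (1 / 2) ^ l := Finset.sum_le_sum fun l hl ↦ by
          rw [abs_mul, mul_assoc]
          exact mul_le_mul (ha l (Finset.mem_of_mem_erase hl))
            (hoff l i (Finset.ne_of_mem_erase hl)) (abs_nonneg _) (abs_nonneg _)
      _ ≤ |a i| * (ε / 4) * 2 := by
          rw [← Finset.mul_sum]
          refine mul_le_mul_of_nonneg_left ?_ (by positivity)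
          exact (summable_geometric_two.sum_le_tsum _ fun _ _ ↦ by positivity).trans_eq
            tsum_geometric_two
      _ = ε / 2 * |a i| := by ring
  have hmain : ε * |a i| ≤ |a i * T (x i) (j i)| := by
    rw [abs_mul, mul_comm]
    exact mul_le_mul_of_nonneg_left (hdiag i).le (abs_nonneg _)
  have htri := abs_sub_abs_le_abs_add (a i * T (x i) (j i))
    (∑ l ∈ s.erase i, a l * T (x l) (j i))
  rw [heq]
  linarith

end CZero

open CZero in
/-- Every strictly singular operator on `c₀` is compact. -/
theorem strictlySingular_isCompactOperator_c0
    (T : C₀(ℕ, ℝ) →L[ℝ] C₀(ℕ, ℝ)) (hT : StrictlySingular T) :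
    IsCompactOperator ⇑T := by
  refine isCompactOperator_of_forall_exists_tail T ?_
  by_contra! ⟨ε, hε, h⟩
  obtain ⟨x, j, hx, hdiag, hdisj, hoff⟩ := exists_almost_diagonal T hε h
  have hmax (a : ℕ →₀ ℝ) (ha : a ≠ 0) : ∃ i ∈ a.support, ∀ l ∈ a.support, |a l| ≤ |a i| :=
    a.support.exists_max_image _ (Finsupp.support_nonempty_iff.2 ha)
  have hli : LinearIndependent ℝ x := by
    rw [linearIndependent_iff]
    intro a ha
    by_contra hne
    obtain ⟨i, hi, hai⟩ := hmax a hne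
    have hle := le_norm_map_sum_smul hε hdiag hoff a.support a hi hai
    rw [Finsupp.linearCombination_apply, Finsupp.sum] at ha
    rw [ha, map_zero, norm_zero] at hle
    have hpos : 0 < |a i| := abs_pos.2 (Finsupp.mem_support_iff.1 hi)
    exact hle.not_gt (by positivity)
  have hinf : ¬ FiniteDimensional ℝ (Submodule.span ℝ (Set.range x)) := fun _ ↦ by
    exact not_finite_iff_infinite.2 inferInstance (linearIndependent_span hli).finite
  obtain ⟨y, hy, hlt⟩ := hT _ hinf (ε / 2) (half_pos hε)
  obtain ⟨a, rfl⟩ := Finsupp.mem_span_range_iff_exists_finsupp.1 hy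
  rcases eq_or_ne a 0 with rfl | hne
  · simp at hlt
  · obtain ⟨i, hi, hai⟩ := hmax a hne
    have hup := norm_sum_smul_le_of_disjoint hx hdisj a.support a (abs_nonneg _) hai
    have hlow := le_norm_map_sum_smul hε hdiag hoff a.support a hi hai
    exact hlt.not_ge ((mul_le_mul_of_nonneg_left hup (half_pos hε).le).trans hlow)
end

section
/- Let m ∈ ℕ with m ≥ 2, let 1 ≤ p_1 < p_2 < ⋯ < p_m < ∞ be real numbers, and let X = ℓ_{p_1} ⊕ ℓ_{p_2} ⊕ ⋯ ⊕ ℓ_{p_m} be their direct sum, normed by ‖(x_1,…,x_m)‖ = max_j ‖x_j‖. Then there exist strictly singular bounded linear operators T_1, …, T_{m-1} : X → X whose composition T_{m-1} ∘ T_{m-2} ∘ ⋯ ∘ T_1 is not compact. -/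
/-- If a strictly singular operator is followed by a bounded operator, the composition is
strictly singular. -/
theorem StrictlySingular.clm_comp {E F G : Type*} [NormedAddCommGroup E] [NormedSpace ℝ E]
    [NormedAddCommGroup F] [NormedSpace ℝ F] [NormedAddCommGroup G] [NormedSpace ℝ G]
    {S : E →L[ℝ] F} (hS : StrictlySingular S) (R : F →L[ℝ] G) :
    StrictlySingular (R.comp S) := by
  intro M hM c hc
  have hR : 0 < ‖R‖ + 1 := by positivity
  obtain ⟨x, hxM, hx⟩ := hS M hM (c / (‖R‖ + 1)) (by positivity)
  refine ⟨x, hxM, ?_⟩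
  rw [div_mul_eq_mul_div, lt_div_iff₀ hR] at hx
  have h := R.le_opNorm (S x)
  have h' := norm_nonneg (S x)
  rw [ContinuousLinearMap.comp_apply]
  linarith

/-- If a strictly singular operator is preceded by a bounded operator, the composition is
strictly singular. -/
theorem StrictlySingular.comp_clm {E F G : Type*} [NormedAddCommGroup E] [NormedSpace ℝ E]
    [NormedAddCommGroup F] [NormedSpace ℝ F] [NormedAddCommGroup G] [NormedSpace ℝ G]
    {S : F →L[ℝ] G} (hS : StrictlySingular S) (L : E →L[ℝ] F) :
    StrictlySingular (S.comp L) := by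
  intro M hM c hc
  by_cases hL : Function.Injective (L.toLinearMap.domRestrict M)
  · have hM' : ¬ FiniteDimensional ℝ (M.map L.toLinearMap) := fun h => by
      refine hM (FiniteDimensional.of_injective
        ((L.toLinearMap.domRestrict M).codRestrict (M.map L.toLinearMap)
          fun x => Submodule.mem_map_of_mem x.2) ?_)
      exact fun x y hxy => hL (congrArg Subtype.val hxy)
    have hL' : 0 < ‖L‖ + 1 := by positivity
    obtain ⟨_, ⟨x, hxM, rfl⟩, hx⟩ := hS _ hM' (c / (‖L‖ + 1)) (by positivity)
    refine ⟨x, hxM, hx.trans_le ?_⟩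
    rw [div_mul_eq_mul_div, div_le_iff₀ hL', mul_assoc]
    gcongr
    have h := L.le_opNorm x
    have h' := norm_nonneg x
    simp only [ContinuousLinearMap.coe_coe]
    linarith
  · rw [injective_iff_map_eq_zero] at hL
    push Not at hL
    obtain ⟨x, hLx, hx⟩ := hL
    refine ⟨x, x.2, ?_⟩
    have hLx' : L x = 0 := hLx
    have hx' : (x : E) ≠ 0 := by simpa using hx
    simp only [ContinuousLinearMap.comp_apply, hLx', map_zero, norm_zero]
    positivity

/-- An infinite-dimensional space of bounded real functions contains, for every `n`, a function
bounded by `1` having modulus at least `1 / 2` at `n` points. -/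
theorem exists_abs_le_one_and_half_le_abs {ι V : Type*} [AddCommGroup V] [Module ℝ V]
    (hV : ¬ FiniteDimensional ℝ V) (φ : V →ₗ[ℝ] ι → ℝ) (hφ : Function.Injective φ)
    (hbdd : ∀ x, ∃ B, ∀ k, |φ x k| ≤ B) (n : ℕ) :
    ∃ (x : V) (A : Finset ι), A.card = n ∧ (∀ k, |φ x k| ≤ 1) ∧ ∀ k ∈ A, 1 / 2 ≤ |φ x k| := by
  classical
  induction n with
  | zero => exact ⟨0, ∅, by simp⟩
  | succ n ih =>
    obtain ⟨x, A, hA, hx, hxA⟩ := ih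
    obtain ⟨y, hyA, hy⟩ : ∃ y : V, (∀ k ∈ A, φ y k = 0) ∧ y ≠ 0 := by
      let ψ : V →ₗ[ℝ] A → ℝ := (LinearMap.funLeft ℝ ℝ ((↑) : A → ι)).comp φ
      have hψ : ¬ Function.Injective ψ := fun h => hV (FiniteDimensional.of_injective ψ h)
      rw [injective_iff_map_eq_zero] at hψ
      push Not at hψ
      obtain ⟨y, hψy, hy⟩ := hψ
      exact ⟨y, fun k hk => congrFun hψy ⟨k, hk⟩, hy⟩
    obtain ⟨k₀, hk₀⟩ : ∃ k, φ y k ≠ 0 := by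
      by_contra! h
      exact hy (hφ (by rw [map_zero]; exact funext h))
    obtain ⟨B, hB⟩ := hbdd y
    have hk₀' : 0 < |φ y k₀| := abs_pos.2 hk₀
    have hBpos : 0 < B := hk₀'.trans_le (hB k₀)
    by_contra! hcon
    let z : ℕ → V := fun j => x + ((j : ℝ) * (1 / (2 * B))) • y
    have hz (j k) : φ (z j) k = φ x k + (j : ℝ) * (1 / (2 * B)) * φ y k := by simp [z]
    have hzA (j k) (hk : k ∈ A) : φ (z j) k = φ x k := by simp [hz, hyA k hk]
    have hbox (j) : ∀ k, |φ (z j) k| ≤ 1 := by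
      induction j with
      | zero => intro k; simpa [hz] using hx k
      | succ j ihj =>
        intro k
        by_cases hk : k ∈ A
        · rw [hzA _ _ hk]; exact hx k
        have hlt : |φ (z j) k| < 1 / 2 := by
          obtain ⟨l, hl, hl'⟩ := hcon (z j) (insert k A)
            (by rw [Finset.card_insert_of_notMem hk, hA]) ihj
          rcases Finset.mem_insert.1 hl with rfl | hl
          · exact hl'
          · rw [hzA _ _ hl] at hl'
            exact absurd (hxA l hl) hl'.not_ge
        have hstep : φ (z (j + 1)) k = φ (z j) k + 1 / (2 * B) * φ y k := by
          rw [hz, hz]; push_cast; ring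
        have hsmall : |1 / (2 * B) * φ y k| ≤ 1 / 2 := by
          rw [abs_mul, abs_of_pos (by positivity : 0 < 1 / (2 * B)), div_mul_eq_mul_div,
            div_le_iff₀ (by positivity)]
          linarith [hB k]
        rw [hstep]
        linarith [abs_add_le (φ (z j) k) (1 / (2 * B) * φ y k)]
    have hpos : 0 < 1 / (2 * B) * |φ y k₀| := by positivity
    obtain ⟨j, hj⟩ := exists_nat_gt (2 / (1 / (2 * B) * |φ y k₀|))
    rw [div_lt_iff₀ hpos] at hj
    have h1 := abs_sub (φ (z j) k₀) (φ x k₀)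
    have h2 : φ (z j) k₀ - φ x k₀ = (j : ℝ) * (1 / (2 * B)) * φ y k₀ := by rw [hz]; ring
    rw [h2, abs_mul, abs_of_nonneg (by positivity : 0 ≤ (j : ℝ) * (1 / (2 * B)))] at h1
    linarith [hbox j k₀, hx k₀]

namespace lp

open scoped ENNReal

variable {ι : Type*} {p q : ℝ≥0∞}

theorem norm_linearMapOfLE_rpow_le (hp : 0 < p.toReal) (hq : q ≠ ∞) (h : p ≤ q)
    (x : lp (fun _ : ι => ℝ) p) (hx : ∀ k, |x k| ≤ 1) :
    ‖linearMapOfLE ℝ (fun _ : ι => ℝ) h x‖ ^ q.toReal ≤ ‖x‖ ^ p.toReal := by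
  have hpq : p.toReal ≤ q.toReal := ENNReal.toReal_mono hq h
  rw [norm_rpow_eq_tsum hp, norm_rpow_eq_tsum (hp.trans_le hpq)]
  refine Summable.tsum_le_tsum (fun k => ?_) ((lp.memℓp _).summable (hp.trans_le hpq))
    ((lp.memℓp x).summable hp)
  rw [coe_linearMapOfLE_apply]
  exact Real.rpow_le_rpow_of_exponent_ge' (norm_nonneg _) (hx k) hp.le hpq

theorem norm_linearMapOfLE_le [Fact (1 ≤ p)] [Fact (1 ≤ q)] (hq : q ≠ ∞) (h : p ≤ q)
    (x : lp (fun _ : ι => ℝ) p) : ‖linearMapOfLE ℝ (fun _ : ι => ℝ) h x‖ ≤ ‖x‖ := by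
  have hp0 : p ≠ 0 := (zero_lt_one.trans_le (Fact.out : 1 ≤ p)).ne'
  have hp : 0 < p.toReal := ENNReal.toReal_pos hp0 (ne_top_of_le_ne_top hq h)
  have hq' : 0 < q.toReal := hp.trans_le (ENNReal.toReal_mono hq h)
  rcases eq_or_ne x 0 with rfl | hx
  · simp
  have hx' : 0 < ‖x‖ := norm_pos_iff.2 hx
  have hunit : ‖‖x‖⁻¹ • x‖ = 1 := by
    rw [norm_smul, norm_inv, norm_norm, inv_mul_cancel₀ hx'.ne']
  have key := norm_linearMapOfLE_rpow_le hp hq h (‖x‖⁻¹ • x)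
    fun k => (norm_apply_le_norm hp0 _ k).trans hunit.le
  rw [hunit, Real.one_rpow, ← Real.one_rpow q.toReal,
    Real.rpow_le_rpow_iff (norm_nonneg _) zero_le_one hq', map_smul, norm_smul, norm_inv,
    norm_norm, inv_mul_le_iff₀ hx', mul_one] at key
  exact key

/-- The inclusion `ℓ_p → ℓ_q` for `p ≤ q < ∞`, as a bounded operator. -/
noncomputable def inclusionCLM [Fact (1 ≤ p)] [Fact (1 ≤ q)] (hq : q ≠ ∞) (h : p ≤ q) :
    lp (fun _ : ι => ℝ) p →L[ℝ] lp (fun _ : ι => ℝ) q :=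
  (linearMapOfLE ℝ (fun _ : ι => ℝ) h).mkContinuous 1 fun x => by
    rw [one_mul]; exact norm_linearMapOfLE_le hq h x

theorem inclusionCLM_single [DecidableEq ι] [Fact (1 ≤ p)] [Fact (1 ≤ q)] (hq : q ≠ ∞)
    (h : p ≤ q) (k : ι) (a : ℝ) :
    inclusionCLM hq h (lp.single p k a : lp (fun _ : ι => ℝ) p) = lp.single q k a := rfl

theorem strictlySingular_inclusionCLM [Fact (1 ≤ p)] [Fact (1 ≤ q)] (hq : q ≠ ∞) (h : p < q) :
    StrictlySingular (inclusionCLM (ι := ι) hq h.le) := by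
  have hp0 : p ≠ 0 := (zero_lt_one.trans_le (Fact.out : 1 ≤ p)).ne'
  have hp : 0 < p.toReal := ENNReal.toReal_pos hp0 h.ne_top
  have hpq : p.toReal < q.toReal := (ENNReal.toReal_lt_toReal h.ne_top hq).2 h
  intro M hM c hc
  by_contra! hcon
  let φ : M →ₗ[ℝ] ι → ℝ := LinearMap.pi fun k => (evalₗ (p := p) (E := fun _ : ι => ℝ) (𝕜 := ℝ) k).comp M.subtype
  have hφ : Function.Injective φ := fun x y hxy => Subtype.ext (lp.ext hxy)
  obtain ⟨C, hC⟩ : ∃ C : ℝ, ∀ x : lp (fun _ : ι => ℝ) p, x ∈ M → (∀ k, |x k| ≤ 1) →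
      ‖x‖ ^ p.toReal ≤ C := by
    have hr : 0 < q.toReal - p.toReal := sub_pos.2 hpq
    refine ⟨(c ^ q.toReal)⁻¹ ^ (p.toReal / (q.toReal - p.toReal)), fun x hxM hx => ?_⟩
    rcases eq_or_ne x 0 with rfl | hx0
    · rw [norm_zero, Real.zero_rpow hp.ne']; positivity
    have hx' : 0 < ‖x‖ := norm_pos_iff.2 hx0
    have h1 : (c * ‖x‖) ^ q.toReal ≤ ‖x‖ ^ p.toReal :=
      (Real.rpow_le_rpow (by positivity) (hcon x hxM) (hp.trans hpq).le).trans
        (norm_linearMapOfLE_rpow_le hp hq h.le x hx)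
    have h2 : ‖x‖ ^ (q.toReal - p.toReal) ≤ (c ^ q.toReal)⁻¹ := by
      rw [Real.rpow_sub hx', div_le_iff₀ (by positivity), inv_mul_eq_div,
        le_div_iff₀ (by positivity), mul_comm, ← Real.mul_rpow hc.le hx'.le]
      exact h1
    calc ‖x‖ ^ p.toReal = (‖x‖ ^ (q.toReal - p.toReal)) ^ (p.toReal / (q.toReal - p.toReal)) := by
          rw [← Real.rpow_mul hx'.le, mul_div_cancel₀ _ hr.ne']
      _ ≤ _ := Real.rpow_le_rpow (by positivity) h2 (by positivity)
  obtain ⟨n, hn⟩ := exists_nat_gt (C / (1 / 2) ^ p.toReal)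
  obtain ⟨x, A, hA, hx, hxA⟩ := exists_abs_le_one_and_half_le_abs hM φ hφ
    (fun x => ⟨‖x‖, fun k => norm_apply_le_norm hp0 (x : lp (fun _ : ι => ℝ) p) k⟩) n
  rw [div_lt_iff₀ (by positivity)] at hn
  refine hn.not_ge (le_trans ?_ (hC x x.2 hx))
  refine le_trans ?_ (sum_rpow_le_norm_rpow hp (x : lp (fun _ : ι => ℝ) p) A)
  rw [← hA, ← nsmul_eq_mul]
  exact Finset.card_nsmul_le_sum _ _ _ fun k hk =>
    Real.rpow_le_rpow (by norm_num) (hxA k hk) hp.le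

end lp

/-- If each `T i` maps `w (i + 1)` to `w i`, then the product of the `T i` maps `w n` to `w 0`. -/
theorem List.prod_ofFn_apply_of_chain {E : Type*} [NormedAddCommGroup E] [NormedSpace ℝ E] {n : ℕ}
    (T : Fin n → E →L[ℝ] E) (w : ℕ → E) (hw : ∀ i : Fin n, T i (w (i + 1)) = w i) :
    (List.ofFn T).prod (w n) = w 0 := by
  induction n generalizing w with
  | zero => simp
  | succ n ih =>
    rw [List.ofFn_succ, List.prod_cons, mul_apply_eq_comp,
      ih (fun i => T i.succ) (fun i => w (i + 1)) fun i => hw i.succ]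
    exact hw 0

/-- On `X = ℓ_{p 1} ⊕ ⋯ ⊕ ℓ_{p m}` (max norm), where `m ≥ 2` and `1 ≤ p 1 < ⋯ < p m < ∞`,
there exist `m - 1` strictly singular operators whose composition is not compact. -/
theorem exists_strictlySingular_comp_not_compact_directSum_lp
    (m : ℕ) (hm : 2 ≤ m) (p : Fin m → ℝ) (hp1 : ∀ j, 1 ≤ p j) (hmono : StrictMono p)
    [∀ j, Fact (1 ≤ ENNReal.ofReal (p j))] :
    ∃ T : Fin (m - 1) → ((∀ j : Fin m, lp (fun _ : ℕ => ℝ) (ENNReal.ofReal (p j))) →L[ℝ]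
      (∀ j : Fin m, lp (fun _ : ℕ => ℝ) (ENNReal.ofReal (p j)))),
      (∀ i, StrictlySingular (T i)) ∧ ¬ IsCompactOperator ⇑((List.ofFn T).prod) := by
  let a : ℕ → Fin m := fun j => ⟨m - 1 - j, by omega⟩
  have ha (i : Fin (m - 1)) :
      ENNReal.ofReal (p (a (i + 1))) < ENNReal.ofReal (p (a i)) := by
    refine (ENNReal.ofReal_lt_ofReal_iff (zero_lt_one.trans_le (hp1 _))).2 (hmono ?_)
    simp only [a, Fin.mk_lt_mk]
    omega
  let T (i : Fin (m - 1)) : (∀ j : Fin m, lp (fun _ : ℕ => ℝ) (ENNReal.ofReal (p j))) →L[ℝ]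
      (∀ j : Fin m, lp (fun _ : ℕ => ℝ) (ENNReal.ofReal (p j))) :=
    ((ContinuousLinearMap.single ℝ
      (fun j : Fin m => lp (fun _ : ℕ => ℝ) (ENNReal.ofReal (p j))) (a i)).comp
        (lp.inclusionCLM ENNReal.ofReal_ne_top (ha i).le)).comp
      (ContinuousLinearMap.proj (a (i + 1)))
  refine ⟨T, fun i => ((lp.strictlySingular_inclusionCLM ENNReal.ofReal_ne_top
    (ha i)).clm_comp _).comp_clm _, fun hcomp => ?_⟩
  let w (k j : ℕ) : ∀ j : Fin m, lp (fun _ : ℕ => ℝ) (ENNReal.ofReal (p j)) :=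
    Pi.single (a j) (lp.single _ k (1 : ℝ))
  have hTw (k) : (List.ofFn T).prod (w k (m - 1)) = w k 0 := by
    refine List.prod_ofFn_apply_of_chain T (w k) fun i => ?_
    simp [T, w, lp.inclusionCLM_single]
  have hpos (j) : 0 < ENNReal.ofReal (p j) := ENNReal.ofReal_pos.2 (zero_lt_one.trans_le (hp1 j))
  obtain ⟨K, hK, hsub⟩ := IsCompactOperator.image_closedBall_subset_compact
    (f := (List.ofFn T).prod.toLinearMap) hcomp 1
  have hmem (k) : w k 0 ∈ K := by
    refine hsub ⟨w k (m - 1), ?_, hTw k⟩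
    rw [mem_closedBall_zero_iff, Pi.norm_single, lp.norm_single (hpos _), norm_one]
  obtain ⟨_, -, s, hs, hlim⟩ := hK.tendsto_subseq hmem
  obtain ⟨N, hN⟩ := Metric.cauchySeq_iff.1 hlim.cauchySeq 1 one_pos
  have h1 := hN N le_rfl (N + 1) N.le_succ
  have hne : s N ≠ s (N + 1) := (hs N.lt_succ_self).ne
  refine h1.not_ge ?_
  rw [dist_eq_norm]
  refine le_trans ?_ (norm_le_pi_norm _ (a 0))
  refine le_trans ?_ (lp.norm_apply_le_norm (hpos _).ne' _ (s N))
  simp [w, hne]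
end

section
/- Let 1 ≤ p < ∞ be a real number and let x : ℕ → ℝ be a sequence (indexed by the positive integers) such that x(n) ≥ 0 for all n ≥ 1, x(n) ≥ x(n+1) for all n ≥ 1 (x is decreasing), and for every nonempty Schreier set F one has ∑_{j∈F} x(j)^p ≤ 1. Then for every integer n ≥ 0, x(2^{n+1}) ≤ 2^{−n/p}. -/
/-- A *Schreier set* is a finite set `F` of positive integers such that either `F = ∅` or
`|F| ≤ min F`; equivalently, `F.card ≤ n` for every `n ∈ F` (for nonempty `F` this forces
all elements of `F` to be positive). -/
def IsSchreier (F : Finset ℕ) : Prop := ∀ n ∈ F, F.card ≤ n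

/-- If `x` is a nonnegative decreasing sequence (indexed by the positive integers) with
`∑_{j ∈ F} x j ^ p ≤ 1` for every nonempty Schreier set `F`, where `1 ≤ p < ∞`, then
`x (2 ^ (n + 1)) ≤ 2 ^ (-n / p)` for every `n ≥ 0`. -/
theorem schreier_bound_pow_two (p : ℝ) (hp : 1 ≤ p) (x : ℕ → ℝ)
    (hnonneg : ∀ n : ℕ, 1 ≤ n → 0 ≤ x n)
    (hdec : ∀ n : ℕ, 1 ≤ n → x (n + 1) ≤ x n)
    (hS : ∀ F : Finset ℕ, F.Nonempty → IsSchreier F → ∑ j ∈ F, x j ^ p ≤ 1) :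
    ∀ n : ℕ, x (2 ^ (n + 1)) ≤ (2 : ℝ) ^ (-(n : ℝ) / p) := by
  intro n
  have hanti : AntitoneOn x (Set.Ici 1) := by
    intro a ha b _ hab
    induction b, hab using Nat.le_induction with
    | base => exact le_rfl
    | succ k hk ih =>
      have hk1 : 1 ≤ k := le_trans ha hk
      exact (hdec k hk1).trans (ih hk1)
  have hpos : 0 < p := by linarith
  have hx0 : 0 ≤ x (2 ^ (n + 1)) := hnonneg _ Nat.one_le_two_pow
  have hcard : (Finset.Ico (2 ^ n) (2 ^ (n + 1))).card = 2 ^ n := by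
    rw [Nat.card_Ico, pow_succ]
    omega
  have hne : (Finset.Ico (2 ^ n) (2 ^ (n + 1))).Nonempty := by
    rw [← Finset.card_pos, hcard]
    positivity
  have hsum := hS _ hne fun m hm => hcard.trans_le (Finset.mem_Ico.mp hm).1
  have hlow : (2 : ℝ) ^ n * x (2 ^ (n + 1)) ^ p ≤ 1 := by
    refine le_trans ?_ hsum
    have h := Finset.card_nsmul_le_sum (Finset.Ico (2 ^ n) (2 ^ (n + 1))) (fun j => x j ^ p)
      (x (2 ^ (n + 1)) ^ p) fun j hj => by
        obtain ⟨hj1, hj2⟩ := Finset.mem_Ico.mp hj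
        exact Real.rpow_le_rpow hx0
          (hanti (Nat.one_le_two_pow.trans hj1) Nat.one_le_two_pow hj2.le) hpos.le
    rw [hcard, nsmul_eq_mul] at h
    exact_mod_cast h
  rw [← Real.rpow_le_rpow_iff hx0 (by positivity) hpos, ← Real.rpow_mul (by norm_num),
    div_mul_cancel₀ _ hpos.ne', Real.rpow_neg (by norm_num), Real.rpow_natCast,
    ← one_div, le_div_iff₀' (by positivity)]
  exact hlow
end

section
/- Let 1 ≤ p < q < ∞ be real numbers and let x : ℕ → ℝ be a finitely supported sequence (indexed by the positive integers) such that x(n) ≥ 0 for all n ≥ 1, x(n) ≥ x(n+1) for all n ≥ 1 (x is decreasing), and for every nonempty Schreier set F one has ∑_{j∈F} x(j)^p ≤ 1. Then ∑_{n=1}^∞ x(n)^q ≤ (2^{q/p} − 1) / (2^{(q−p)/p} − 1). -/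
open Finset in
/-- The dyadic interval `[m, 2m)` is a Schreier set. -/
lemma isSchreier_Ico_two_mul (m : ℕ) : IsSchreier (Ico m (2 * m)) := by
  intro n hn
  rw [mem_Ico] at hn
  rw [Nat.card_Ico]
  omega

open Finset in
/-- If `a` is nonnegative and decreasing on the positive integers, with sums at most `1` over the
intervals `[m, 2m)`, then its dyadic `r`-power sums are dominated by geometric sums. -/
lemma sum_Ico_two_pow_rpow_le {r : ℝ} (hr : 1 < r) {a : ℕ → ℝ}
    (ha : ∀ n, 1 ≤ n → 0 ≤ a n) (hanti : AntitoneOn a (Set.Ici 1))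
    (hsum : ∀ m, 1 ≤ m → ∑ j ∈ Ico m (2 * m), a j ≤ 1) (K : ℕ) :
    ∑ n ∈ Ico 1 (2 ^ (K + 1)), a n ^ r ≤ 1 + ∑ j ∈ range K, (((2 : ℝ) ^ (r - 1))⁻¹) ^ j := by
  induction K with
  | zero =>
    have h1 : a 1 ≤ 1 := by simpa using hsum 1 le_rfl
    simpa using Real.rpow_le_one (ha 1 le_rfl) h1 (by linarith)
  | succ K ih =>
    have hpos : 1 ≤ 2 ^ K := Nat.one_le_two_pow
    have hpos' : 1 ≤ 2 ^ (K + 1) := Nat.one_le_two_pow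
    have hbound : ∀ n, 2 ^ (K + 1) ≤ n → a n ≤ ((2 : ℝ) ^ K)⁻¹ := by
      intro n hn
      have h : ∑ j ∈ Ico (2 ^ K) (2 * 2 ^ K), a n ≤ 1 := by
        refine (sum_le_sum fun j hj => ?_).trans (hsum _ hpos)
        rw [mem_Ico] at hj
        rw [pow_succ] at hn
        exact hanti (Set.mem_Ici.2 (by omega)) (Set.mem_Ici.2 (by omega)) (by omega)
      rw [sum_const, Nat.card_Ico, show 2 * 2 ^ K - 2 ^ K = 2 ^ K by omega, nsmul_eq_mul] at h
      push_cast at h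
      rwa [← one_div, le_div_iff₀' (by positivity)]
    have hterm : ∀ n ∈ Ico (2 ^ (K + 1)) (2 * 2 ^ (K + 1)),
        a n ^ r ≤ (((2 : ℝ) ^ (r - 1))⁻¹) ^ K * a n := by
      intro n hn
      rw [mem_Ico] at hn
      have hn0 := ha n (by omega)
      have hsplit : a n ^ r = a n ^ (r - 1) * a n := by
        rw [← Real.rpow_add_one' hn0 (by linarith), sub_add_cancel]
      rw [hsplit]
      refine mul_le_mul_of_nonneg_right ?_ hn0
      refine (Real.rpow_le_rpow hn0 (hbound n hn.1) (by linarith)).trans_eq ?_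
      rw [Real.inv_rpow (by positivity), inv_pow, Real.rpow_pow_comm (by norm_num)]
    have hblock : ∑ n ∈ Ico (2 ^ (K + 1)) (2 * 2 ^ (K + 1)), a n ^ r ≤
        (((2 : ℝ) ^ (r - 1))⁻¹) ^ K := by
      refine (sum_le_sum hterm).trans ?_
      rw [← mul_sum]
      exact mul_le_of_le_one_right (by positivity) (hsum _ hpos')
    rw [pow_succ' 2 (K + 1), ← sum_Ico_consecutive _ hpos' (by omega), sum_range_succ]
    linarith

/-- If `x` is a finitely supported, nonnegative, decreasing sequence (indexed by the positive
integers) with `∑_{j ∈ F} x j ^ p ≤ 1` for every nonempty Schreier set `F`, where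
`1 ≤ p < q < ∞`, then `∑_{n ≥ 1} x n ^ q ≤ (2 ^ (q/p) - 1) / (2 ^ ((q-p)/p) - 1)`. -/
theorem schreier_lq_sum_bound (p q : ℝ) (hp : 1 ≤ p) (hpq : p < q) (x : ℕ → ℝ)
    (hfin : (Function.support x).Finite)
    (hnonneg : ∀ n : ℕ, 1 ≤ n → 0 ≤ x n)
    (hdec : ∀ n : ℕ, 1 ≤ n → x (n + 1) ≤ x n)
    (hS : ∀ F : Finset ℕ, F.Nonempty → IsSchreier F → ∑ j ∈ F, x j ^ p ≤ 1) :
    ∑' n : ℕ, x (n + 1) ^ q ≤ ((2 : ℝ) ^ (q / p) - 1) / ((2 : ℝ) ^ ((q - p) / p) - 1) := by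
  have hp0 : 0 < p := by linarith
  have hr : 1 < q / p := (one_lt_div hp0).2 hpq
  have hexp : (q - p) / p = q / p - 1 := by rw [sub_div, div_self hp0.ne']
  have hanti : AntitoneOn x (Set.Ici 1) := by
    intro m hm n _ hmn
    induction n, hmn using Nat.le_induction with
    | base => exact le_rfl
    | succ n hmn ih =>
      have hn : 1 ≤ n := le_trans hm hmn
      exact (hdec n hn).trans (ih hn)
  have hpow : ∀ n, 1 ≤ n → (x n ^ p) ^ (q / p) = x n ^ q := by
    intro n hn
    rw [← Real.rpow_mul (hnonneg n hn), mul_div_cancel₀ _ hp0.ne']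
  have hdyadic := sum_Ico_two_pow_rpow_le hr (a := fun n => x n ^ p)
    (fun n hn => Real.rpow_nonneg (hnonneg n hn) p)
    (fun m hm n hn hmn => Real.rpow_le_rpow (hnonneg n hn) (hanti hm hn hmn) hp0.le)
    (fun m hm => hS _ (Finset.nonempty_Ico.2 (by omega)) (isSchreier_Ico_two_mul m))
  have ht : 1 < (2 : ℝ) ^ (q / p - 1) := Real.one_lt_rpow (by norm_num) (by linarith)
  have htwo : (2 : ℝ) ^ (q / p) = 2 * 2 ^ (q / p - 1) := by
    rw [Real.rpow_sub_one (by norm_num)]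
    ring
  rw [hexp, htwo]
  set t : ℝ := 2 ^ (q / p - 1)
  have ht0 : 0 < t := by linarith
  have hgeom : ∀ K, ∑ j ∈ Finset.range K, t⁻¹ ^ j ≤ (1 - t⁻¹)⁻¹ := fun K => by
    have h0 : 0 ≤ t⁻¹ := by positivity
    have h1 : t⁻¹ < 1 := inv_lt_one_of_one_lt₀ ht
    rw [← tsum_geometric_of_lt_one h0 h1]
    exact (summable_geometric_of_lt_one h0 h1).sum_le_tsum _ fun j _ => pow_nonneg h0 j
  have hval : (2 * t - 1) / (t - 1) = 1 + (1 - t⁻¹)⁻¹ := by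
    have h1 : t - 1 ≠ 0 := by linarith
    have h2 : 1 - t⁻¹ = (t - 1) / t := by field_simp
    rw [h2, inv_div]
    field_simp
    ring
  refine Real.tsum_le_of_sum_range_le
    (fun n => Real.rpow_nonneg (hnonneg _ (by omega)) q) fun N => ?_
  calc ∑ n ∈ Finset.range N, x (n + 1) ^ q
      = ∑ n ∈ Finset.Ico 1 (N + 1), x n ^ q := by
        rw [Finset.sum_Ico_eq_sum_range]
        simp [add_comm]
    _ ≤ ∑ n ∈ Finset.Ico 1 (2 ^ (N + 1)), x n ^ q := by
        refine Finset.sum_le_sum_of_subset_of_nonneg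
          (Finset.Ico_subset_Ico_right Nat.lt_two_pow_self.le) fun n hn _ => ?_
        exact Real.rpow_nonneg (hnonneg n (Finset.mem_Ico.1 hn).1) q
    _ = ∑ n ∈ Finset.Ico 1 (2 ^ (N + 1)), (x n ^ p) ^ (q / p) :=
        Finset.sum_congr rfl fun n hn => (hpow n (Finset.mem_Ico.1 hn).1).symm
    _ ≤ 1 + ∑ j ∈ Finset.range N, t⁻¹ ^ j := hdyadic N
    _ ≤ (2 * t - 1) / (t - 1) := by
        rw [hval]
        gcongr
        exact hgeom N
end

section
/- Let 1 ≤ p < q < ∞ be real numbers. Then there exists a constant C > 0 such that for every finitely supported sequence x : ℕ → ℝ (indexed by the positive integers), (∑_{n=1}^∞ |x(n)|^q)^{1/q} ≤ C · sup{ (∑_{n∈F} |x(n)|^p)^{1/p} : F a nonempty Schreier set }. In other words, the ℓ_q-norm of x is at most C times the Schreier p-norm of x. -/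
/-- Every finite set `B` of naturals has a subset of at least half its size whose shift by one
is a Schreier set. -/
lemma exists_subset_card_le_succ (B : Finset ℕ) :
    ∃ F ⊆ B, B.card ≤ 2 * F.card ∧ ∀ n ∈ F, F.card ≤ n + 1 := by
  have h_small : (B.filter fun n => ¬ B.card / 2 ≤ n).card ≤ B.card / 2 := by
    calc _ ≤ (Finset.range (B.card / 2)).card := Finset.card_le_card fun n hn => by
          have := (Finset.mem_filter.1 hn).2
          exact Finset.mem_range.2 (by omega)
      _ = _ := Finset.card_range _
  have h_split := Finset.card_filter_add_card_filter_not (s := B) fun n => B.card / 2 ≤ n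
  obtain ⟨F, hF, hcard⟩ := Finset.exists_subset_card_eq
    (s := B.filter fun n => B.card / 2 ≤ n) (n := B.card - B.card / 2) (by omega)
  refine ⟨F, hF.trans (Finset.filter_subset _ _), by omega, fun n hn => ?_⟩
  have := (Finset.mem_filter.1 (hF hn)).2
  omega

/-- A weak `ℓ₁` bound on a nonnegative function gives a bound for the sum of its `r`-th powers. -/
lemma sum_rpow_le_of_card_mul_le {ι : Type*} {f : ι → ℝ} (hf : ∀ i, 0 ≤ f i) {K r : ℝ}
    (hK : 0 ≤ K) (hr : 0 ≤ r) (h : ∀ (B : Finset ι) (t : ℝ), 0 ≤ t → (∀ i ∈ B, t ≤ f i) →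
      (B.card : ℝ) * t ≤ K) (A : Finset ι) :
    ∑ i ∈ A, f i ^ r ≤ K ^ r * ∑ k ∈ Finset.range A.card, 1 / ((k + 1 : ℕ) : ℝ) ^ r := by
  classical
  induction hn : A.card generalizing A with
  | zero => simp [Finset.card_eq_zero.1 hn]
  | succ n ih =>
    obtain ⟨m, hm, hmin⟩ := A.exists_min_image f (Finset.card_pos.1 (by omega))
    have h_erase := ih (A.erase m) (by rw [Finset.card_erase_of_mem hm]; omega)
    have h_min : f m ≤ K / ((n + 1 : ℕ) : ℝ) := by
      rw [le_div_iff₀ (by positivity), mul_comm, ← hn]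
      exact h A (f m) (hf m) hmin
    have h_pow : f m ^ r ≤ K ^ r * (1 / ((n + 1 : ℕ) : ℝ) ^ r) := by
      rw [mul_one_div, ← Real.div_rpow hK (by positivity)]
      exact Real.rpow_le_rpow (hf m) h_min hr
    rw [← Finset.add_sum_erase A _ hm, Finset.sum_range_succ, mul_add]
    linarith

lemma bddAbove_schreier_image {x : ℕ → ℝ} (hx : (Function.support x).Finite) {p : ℝ}
    (hp : 0 < p) :
    BddAbove ((fun F : Finset ℕ => (∑ n ∈ F, |x n| ^ p) ^ (1 / p)) ''
      {F | F.Nonempty ∧ IsSchreier F}) := by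
  refine ⟨(∑ n ∈ hx.toFinset, |x n| ^ p) ^ (1 / p), ?_⟩
  rintro _ ⟨F, -, rfl⟩
  refine Real.rpow_le_rpow (by positivity) ?_ (by positivity)
  classical
  calc _ ≤ ∑ n ∈ F ∪ hx.toFinset, |x n| ^ p :=
        Finset.sum_le_sum_of_subset_of_nonneg Finset.subset_union_left
          fun n _ _ => by positivity
    _ = _ := by
        refine (Finset.sum_subset Finset.subset_union_right fun n _ hn => ?_).symm
        have : x n = 0 := by simpa using hn
        simp [this, hp.ne']

/-- The Schreier `p`-norm dominates the weak `ℓ_p`-quasinorm. -/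
lemma card_mul_le_schreier {x : ℕ → ℝ} (hx : (Function.support x).Finite) {p : ℝ}
    (hp : 0 < p) (B : Finset ℕ) {t : ℝ} (ht : 0 ≤ t) (hB : ∀ n ∈ B, t ≤ |x (n + 1)| ^ p) :
    (B.card : ℝ) * t ≤ 2 * sSup ((fun F : Finset ℕ => (∑ n ∈ F, |x n| ^ p) ^ (1 / p)) ''
      {F | F.Nonempty ∧ IsSchreier F}) ^ p := by
  set S := sSup ((fun F : Finset ℕ => (∑ n ∈ F, |x n| ^ p) ^ (1 / p)) ''
      {F | F.Nonempty ∧ IsSchreier F}) with hS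
  have hS0 : 0 ≤ S := Real.sSup_nonneg (by rintro _ ⟨F, -, rfl⟩; positivity)
  obtain ⟨F, hFB, hcard, hF⟩ := exists_subset_card_le_succ B
  rcases F.eq_empty_or_nonempty with rfl | hne
  · have : B.card = 0 := by simpa using hcard
    rw [this]
    simp only [Nat.cast_zero, zero_mul]
    positivity
  have h_norm : (∑ n ∈ F, |x (n + 1)| ^ p) ^ (1 / p) ≤ S := by
    refine le_csSup (bddAbove_schreier_image hx hp)
      ⟨F.map (addRightEmbedding 1), ⟨hne.map, ?_⟩, by simp⟩
    intro n hn
    obtain ⟨k, hk, rfl⟩ := Finset.mem_map.1 hn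
    simpa using hF k hk
  have h_sum : ∑ n ∈ F, |x (n + 1)| ^ p ≤ S ^ p := by
    have := Real.rpow_le_rpow (by positivity) h_norm hp.le
    rwa [← Real.rpow_mul (by positivity), one_div_mul_cancel hp.ne', Real.rpow_one] at this
  have h_low : (F.card : ℝ) * t ≤ ∑ n ∈ F, |x (n + 1)| ^ p := by
    rw [← nsmul_eq_mul]
    exact Finset.card_nsmul_le_sum _ _ _ fun n hn => hB n (hFB hn)
  have h_card : (B.card : ℝ) * t ≤ 2 * F.card * t :=
    mul_le_mul_of_nonneg_right (by exact_mod_cast hcard) ht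
  linarith

/-- For `1 ≤ p < q < ∞` there is a constant `C > 0` such that for every finitely supported
sequence `x` (indexed by the positive integers), the `ℓ_q`-norm of `x` is at most `C` times
the Schreier `p`-norm `sup { (∑_{n ∈ F} |x n| ^ p) ^ (1/p) : F a nonempty Schreier set }`. -/
theorem lq_norm_le_schreier_p_norm (p q : ℝ) (hp : 1 ≤ p) (hpq : p < q) :
    ∃ C > (0 : ℝ), ∀ x : ℕ → ℝ, (Function.support x).Finite →
      (∑' n : ℕ, |x (n + 1)| ^ q) ^ (1 / q) ≤
        C * sSup ((fun F : Finset ℕ => (∑ n ∈ F, |x n| ^ p) ^ (1 / p)) ''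
          {F | F.Nonempty ∧ IsSchreier F}) := by
  have hp0 : 0 < p := by linarith
  have hq0 : 0 < q := by linarith
  set r := q / p with hr
  have hr1 : 1 < r := (one_lt_div hp0).2 hpq
  have hpr : p * r = q := mul_div_cancel₀ q hp0.ne'
  have h_summable : Summable fun k : ℕ => 1 / ((k + 1 : ℕ) : ℝ) ^ r :=
    (summable_nat_add_iff 1).2 (Real.summable_one_div_nat_rpow.2 hr1)
  set Z := ∑' k : ℕ, 1 / ((k + 1 : ℕ) : ℝ) ^ r with hZ
  have hZ0 : 0 < Z := h_summable.tsum_pos (fun k => by positivity) 0 (by simp)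
  refine ⟨(2 ^ r * Z) ^ (1 / q), by positivity, fun x hx => ?_⟩
  have h_weak := fun (B : Finset ℕ) (t : ℝ) (ht : 0 ≤ t) =>
    card_mul_le_schreier hx hp0 B ht
  set S := sSup ((fun F : Finset ℕ => (∑ n ∈ F, |x n| ^ p) ^ (1 / p)) ''
      {F | F.Nonempty ∧ IsSchreier F}) with hS
  have hS0 : 0 ≤ S := Real.sSup_nonneg (by rintro _ ⟨F, -, rfl⟩; positivity)
  have h_fin : (Function.support fun n => x (n + 1)).Finite :=
    hx.preimage (add_left_injective 1).injOn
  have h_tsum : ∑' n : ℕ, |x (n + 1)| ^ q = ∑ n ∈ h_fin.toFinset, (|x (n + 1)| ^ p) ^ r := by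
    rw [tsum_eq_sum (s := h_fin.toFinset)]
    · simp_rw [← Real.rpow_mul (abs_nonneg _), hpr]
    · intro n hn
      have : x (n + 1) = 0 := by simpa using hn
      simp [this, hq0.ne']
  have h_bound : ∑' n : ℕ, |x (n + 1)| ^ q ≤ 2 ^ r * Z * S ^ q := by
    rw [h_tsum]
    calc _ ≤ (2 * S ^ p) ^ r * ∑ k ∈ Finset.range h_fin.toFinset.card,
            1 / ((k + 1 : ℕ) : ℝ) ^ r :=
          sum_rpow_le_of_card_mul_le (f := fun n => |x (n + 1)| ^ p) (fun n => by positivity)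
            (by positivity) (by linarith) h_weak _
      _ ≤ (2 * S ^ p) ^ r * Z := by
          gcongr
          exact h_summable.sum_le_tsum _ fun k _ => by positivity
      _ = 2 ^ r * Z * S ^ q := by
          rw [Real.mul_rpow (by norm_num) (by positivity), ← Real.rpow_mul hS0, hpr]
          ring
  calc _ ≤ (2 ^ r * Z * S ^ q) ^ (1 / q) :=
        Real.rpow_le_rpow (tsum_nonneg fun n => by positivity) h_bound (by positivity)
    _ = _ := by
        rw [Real.mul_rpow (by positivity) (by positivity), ← Real.rpow_mul hS0,
          mul_one_div_cancel hq0.ne', Real.rpow_one]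
end
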